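/- arXiv:1810.02281 — 4 statements merged into one kernel-verified Lean document; each statement's English description precedes it below -/
import Mathlib

section
/- Suppose D₁, D₂ ∈ ℝ^{d×d} are non-negative diagonal matrices with non-increasing values along the diagonal, O ∈ ℝ^{d×d} is an orthogonal matrix, and ‖D₁ − O D₂ Oᵀ‖_F ≤ ε for some ε > 0. Then: (1) ‖D₁ − O D₁ Oᵀ‖_F ≤ 2ε, and (2) ‖D₁ − D₂‖_F ≤ ε. -/
open Matrix

/-- Frobenius norm of a real matrix. -/
noncomputable def frobNorm {m n : ℕ} (A : Matrix (Fin m) (Fin n) ℝ) : ℝ :=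
  Real.sqrt (∑ i, ∑ j, (A i j) ^ 2)

section FrobeniusNorm

open scoped Matrix.Norms.Frobenius in
theorem frobNorm_eq_norm {m n : ℕ} (A : Matrix (Fin m) (Fin n) ℝ) : frobNorm A = ‖A‖ := by
  simp [frobNorm, frobenius_norm_def, Real.sqrt_eq_rpow]

open scoped Matrix.Norms.Frobenius in
theorem frobNorm_add_le {m n : ℕ} (A B : Matrix (Fin m) (Fin n) ℝ) :
    frobNorm (A + B) ≤ frobNorm A + frobNorm B := by
  simpa only [frobNorm_eq_norm] using norm_add_le A B

open scoped Matrix.Norms.Frobenius in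
theorem frobNorm_sub_comm {m n : ℕ} (A B : Matrix (Fin m) (Fin n) ℝ) :
    frobNorm (A - B) = frobNorm (B - A) := by
  simpa only [frobNorm_eq_norm] using norm_sub_rev A B

theorem frobNorm_transpose {m n : ℕ} (A : Matrix (Fin m) (Fin n) ℝ) :
    frobNorm Aᵀ = frobNorm A := by
  simp only [frobNorm, transpose_apply]
  rw [Finset.sum_comm]

theorem frobNorm_eq_sqrt_trace {m n : ℕ} (A : Matrix (Fin m) (Fin n) ℝ) :
    frobNorm A = Real.sqrt (trace (A * Aᵀ)) := by
  simp [frobNorm, trace, mul_apply, sq]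

theorem frobNorm_mul_of_mul_transpose_eq_one {m n k : ℕ} (A : Matrix (Fin m) (Fin n) ℝ)
    {U : Matrix (Fin n) (Fin k) ℝ} (hU : U * Uᵀ = 1) : frobNorm (A * U) = frobNorm A := by
  rw [frobNorm_eq_sqrt_trace, frobNorm_eq_sqrt_trace, transpose_mul, Matrix.mul_assoc,
    ← Matrix.mul_assoc U, hU, Matrix.one_mul]

theorem frobNorm_mul_of_transpose_mul_eq_one {m n k : ℕ} {U : Matrix (Fin k) (Fin m) ℝ}
    (A : Matrix (Fin m) (Fin n) ℝ) (hU : Uᵀ * U = 1) : frobNorm (U * A) = frobNorm A := by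
  rw [← frobNorm_transpose, transpose_mul,
    frobNorm_mul_of_mul_transpose_eq_one _ (by rwa [transpose_transpose]), frobNorm_transpose]

theorem frobNorm_diagonal {n : ℕ} (a : Fin n → ℝ) :
    frobNorm (diagonal a) = Real.sqrt (∑ i, a i ^ 2) := by
  simp [frobNorm, diagonal_apply, ite_pow]

end FrobeniusNorm

theorem sq_entries_mem_doublyStochastic {n : Type*} [Fintype n] [DecidableEq n]
    {O : Matrix n n ℝ} (hO : Oᵀ * O = 1) :
    (of fun i j => O i j ^ 2) ∈ doublyStochastic ℝ n := by
  have hO' : O * Oᵀ = 1 := mul_eq_one_comm.mp hO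
  rw [mem_doublyStochastic_iff_sum]
  refine ⟨fun i j => sq_nonneg _, fun i => ?_, fun j => ?_⟩
  · simpa [mul_apply, sq] using congrFun (congrFun hO' i) i
  · simpa [mul_apply, sq] using congrFun (congrFun hO j) j

theorem Monovary.sum_sub_sq_le_sum_sub_comp_perm_sq {n : Type*} [Fintype n] {a b : n → ℝ}
    (hab : Monovary a b) (σ : Equiv.Perm n) :
    ∑ i, (a i - b i) ^ 2 ≤ ∑ i, (a i - b (σ i)) ^ 2 := by
  have hmul := hab.sum_mul_comp_perm_le_sum_mul (σ := σ)
  have hsq := Equiv.sum_comp σ fun i => b i ^ 2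
  simp only [sub_sq, mul_assoc, Finset.sum_add_distrib, Finset.sum_sub_distrib,
    ← Finset.mul_sum]
  linarith

theorem Monovary.sum_sub_sq_le_of_mem_doublyStochastic {n : Type*} [Fintype n] [DecidableEq n]
    {a b : n → ℝ} (hab : Monovary a b) {M : Matrix n n ℝ} (hM : M ∈ doublyStochastic ℝ n) :
    ∑ i, (a i - b i) ^ 2 ≤ ∑ i, ∑ j, (a i - b j) ^ 2 * M i j := by
  obtain ⟨w, hw, hw_sum, rfl⟩ := exists_eq_sum_perm_of_mem_doublyStochastic hM
  calc ∑ i, (a i - b i) ^ 2 = ∑ σ, w σ * ∑ i, (a i - b i) ^ 2 := by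
        rw [← Finset.sum_mul, hw_sum, one_mul]
    _ ≤ ∑ σ, w σ * ∑ i, (a i - b (σ i)) ^ 2 :=
        Finset.sum_le_sum fun σ _ =>
          mul_le_mul_of_nonneg_left (hab.sum_sub_sq_le_sum_sub_comp_perm_sq σ) (hw σ)
    _ = ∑ i, ∑ σ, w σ * (a i - b (σ i)) ^ 2 := by
        simp only [Finset.mul_sum]
        exact Finset.sum_comm
    _ = ∑ i, ∑ j, (a i - b j) ^ 2 * (∑ σ, w σ • σ.permMatrix ℝ) i j := by
        refine Finset.sum_congr rfl fun i _ => ?_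
        simp only [Matrix.sum_apply, Finset.mul_sum]
        rw [Finset.sum_comm]
        refine Finset.sum_congr rfl fun σ _ => ?_
        simp [PEquiv.toMatrix_apply, Equiv.toPEquiv_apply, mul_comm]

/-- The **Hoffman–Wielandt inequality** for real diagonal matrices with similarly ordered
entries. -/
theorem frobNorm_diagonal_sub_le {d : ℕ} {a b : Fin d → ℝ} (hab : Monovary a b)
    {O : Matrix (Fin d) (Fin d) ℝ} (hO : Oᵀ * O = 1) :
    frobNorm (diagonal a - diagonal b) ≤ frobNorm (diagonal a - O * diagonal b * Oᵀ) := by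
  have hcomm : (diagonal a - O * diagonal b * Oᵀ) * O = diagonal a * O - O * diagonal b := by
    rw [Matrix.sub_mul, Matrix.mul_assoc _ Oᵀ, hO, Matrix.mul_one]
  rw [← frobNorm_mul_of_mul_transpose_eq_one (diagonal a - O * diagonal b * Oᵀ)
    (mul_eq_one_comm.mp hO), hcomm, diagonal_sub, frobNorm_diagonal]
  refine Real.sqrt_le_sqrt ((hab.sum_sub_sq_le_of_mem_doublyStochastic
    (sq_entries_mem_doublyStochastic hO)).trans_eq ?_)
  refine Finset.sum_congr rfl fun i _ => Finset.sum_congr rfl fun j _ => ?_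
  simp only [of_apply, Matrix.sub_apply, diagonal_mul, mul_diagonal]
  ring

/-- **Lemma** (diagonal rearrangement): if `D₁, D₂` are non-negative diagonal matrices with
non-increasing diagonals, `O` is orthogonal, and `‖D₁ − O D₂ Oᵀ‖_F ≤ ε`, then
`‖D₁ − O D₁ Oᵀ‖_F ≤ 2ε` and `‖D₁ − D₂‖_F ≤ ε`. -/
theorem diagonal_rearrangement {d : ℕ}
    (D₁ D₂ O : Matrix (Fin d) (Fin d) ℝ) (ε : ℝ) (hε : 0 < ε)
    (hD₁diag : ∀ i j : Fin d, i ≠ j → D₁ i j = 0)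
    (hD₂diag : ∀ i j : Fin d, i ≠ j → D₂ i j = 0)
    (hD₁nonneg : ∀ i : Fin d, 0 ≤ D₁ i i)
    (hD₂nonneg : ∀ i : Fin d, 0 ≤ D₂ i i)
    (hD₁mono : ∀ i j : Fin d, i ≤ j → D₁ j j ≤ D₁ i i)
    (hD₂mono : ∀ i j : Fin d, i ≤ j → D₂ j j ≤ D₂ i i)
    (hO : Oᵀ * O = 1)
    (h : frobNorm (D₁ - O * D₂ * Oᵀ) ≤ ε) :
    frobNorm (D₁ - O * D₁ * Oᵀ) ≤ 2 * ε ∧ frobNorm (D₁ - D₂) ≤ ε := by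
  obtain ⟨a, rfl⟩ : ∃ a, D₁ = diagonal a :=
    ⟨D₁.diag, (IsDiag.diagonal_diag fun i j => hD₁diag i j).symm⟩
  obtain ⟨b, rfl⟩ : ∃ b, D₂ = diagonal b :=
    ⟨D₂.diag, (IsDiag.diagonal_diag fun i j => hD₂diag i j).symm⟩
  simp only [diagonal_apply_eq] at hD₁mono hD₂mono
  have ha : Antitone a := fun i j => hD₁mono i j
  have hb : Antitone b := fun i j => hD₂mono i j
  have hsub := (frobNorm_diagonal_sub_le (ha.monovary hb) hO).trans h
  refine ⟨?_, hsub⟩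
  have hsplit : diagonal a - O * diagonal a * Oᵀ =
      (diagonal a - O * diagonal b * Oᵀ) + O * (diagonal b - diagonal a) * Oᵀ := by
    noncomm_ring
  have hconj : frobNorm (O * (diagonal b - diagonal a) * Oᵀ) =
      frobNorm (diagonal a - diagonal b) := by
    rw [frobNorm_mul_of_mul_transpose_eq_one _ (by rwa [transpose_transpose]),
      frobNorm_mul_of_transpose_mul_eq_one _ hO, frobNorm_sub_comm]
  rw [hsplit]
  linarith [frobNorm_add_le (diagonal a - O * diagonal b * Oᵀ)
    (O * (diagonal b - diagonal a) * Oᵀ)]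
end

section
/- Assume all entries in the matrices W_j ∈ ℝ^{d_j × d_{j−1}}, j = 1,…,N, are drawn independently at random from a Gaussian distribution with mean zero and standard deviation s > 0. Then, for any δ > 0, the probability that W_1,…,W_N are δ-balanced is at least max{0, 1 − 10 δ^{−2} N s⁴ d_max³}, where d_max := max{d₀,…,d_N}. -/
open Matrix MeasureTheory ProbabilityTheory

open scoped NNReal

/-- The fourth moment of a centered Gaussian with variance `v` is `3 v ^ 2`. -/
lemma integral_pow_four_gaussianReal (v : ℝ≥0) :
    ∫ x, x ^ 4 ∂gaussianReal 0 v = 3 * (v : ℝ) ^ 2 := by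
  have hexp (t : ℝ) : HasDerivAt (fun t : ℝ => Real.exp (v * t ^ 2 / 2))
      (Real.exp (v * t ^ 2 / 2) * (v * t)) t := by
    convert! (((hasDerivAt_pow 2 t).const_mul (v : ℝ)).div_const 2).exp using 1
    simp
    ring
  have deriv_mul_exp (p q r : ℝ → ℝ) (hp : ∀ t, HasDerivAt p (q t) t)
      (hr : ∀ t, q t + p t * (v * t) = r t) :
      deriv (fun t => p t * Real.exp (v * t ^ 2 / 2)) =
        fun t => r t * Real.exp (v * t ^ 2 / 2) := by
    ext t
    rw [← hr, ((hp t).fun_mul (hexp t)).deriv]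
    ring
  have deriv_exp : deriv (fun t : ℝ => Real.exp (v * t ^ 2 / 2)) =
      fun t : ℝ => (v * t) * Real.exp (v * t ^ 2 / 2) := by
    ext t
    rw [(hexp t).deriv]
    ring
  have hlin (t : ℝ) : HasDerivAt (fun t : ℝ => (v : ℝ) * t) (v : ℝ) t := by
    simpa using (hasDerivAt_id t).const_mul (v : ℝ)
  have hquad (t : ℝ) : HasDerivAt (fun t : ℝ => (v : ℝ) + (v : ℝ) ^ 2 * t ^ 2)
      (2 * (v : ℝ) ^ 2 * t) t := by
    convert! ((hasDerivAt_pow 2 t).const_mul ((v : ℝ) ^ 2)).const_add (v : ℝ) using 1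
    simp
    ring
  have hcub (t : ℝ) : HasDerivAt (fun t : ℝ => 3 * (v : ℝ) ^ 2 * t + (v : ℝ) ^ 3 * t ^ 3)
      (3 * (v : ℝ) ^ 2 + 3 * (v : ℝ) ^ 3 * t ^ 2) t := by
    convert! ((hasDerivAt_id' t).const_mul (3 * (v : ℝ) ^ 2)).fun_add
      ((hasDerivAt_pow 3 t).const_mul ((v : ℝ) ^ 3)) using 1
    simp
    ring
  calc ∫ x, x ^ 4 ∂gaussianReal 0 v
      = iteratedDeriv 4 (mgf (fun x => x) (gaussianReal 0 v)) 0 := by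
        rw [iteratedDeriv_mgf_zero] <;> simp
    _ = 3 * (v : ℝ) ^ 2 := by
        rw [mgf_fun_id_gaussianReal, iteratedDeriv_succ, iteratedDeriv_succ, iteratedDeriv_succ,
          iteratedDeriv_one]
        simp only [zero_mul, zero_add]
        rw [deriv_exp, deriv_mul_exp _ _ _ hlin fun t => ?_, deriv_mul_exp _ _ _ hquad fun t => ?_,
          deriv_mul_exp _ _
            (fun t => 3 * (v : ℝ) ^ 2 + 6 * (v : ℝ) ^ 3 * t ^ 2 + (v : ℝ) ^ 4 * t ^ 4)
            hcub fun t => ?_]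
        · simp
        all_goals ring

section Products

variable {Ω ι : Type*} {mΩ : MeasurableSpace Ω} {P : Measure Ω}
  {g : ι → Ω → ℝ} {v : ℝ≥0}

lemma ProbabilityTheory.HasLaw.memLp_gaussianReal {X : Ω → ℝ} {μ : ℝ}
    (hX : HasLaw X (gaussianReal μ v) P) (p : ℝ≥0) : MemLp X p P := by
  have h := memLp_id_gaussianReal (μ := μ) (v := v) p
  rw [← hX.map_eq] at h
  exact h.comp_of_map hX.aemeasurable

lemma ProbabilityTheory.HasLaw.integral_gaussianReal_zero {X : Ω → ℝ}
    (hX : HasLaw X (gaussianReal 0 v) P) : ∫ ω, X ω ∂P = 0 := by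
  rw [hX.integral_eq, integral_id_gaussianReal]

lemma ProbabilityTheory.HasLaw.integral_sq_gaussianReal_zero [IsProbabilityMeasure P] {X : Ω → ℝ}
    (hX : HasLaw X (gaussianReal 0 v) P) : ∫ ω, X ω ^ 2 ∂P = v := by
  have h := hX.variance_eq
  rw [variance_eq_sub (by simpa using hX.memLp_gaussianReal 2), hX.integral_gaussianReal_zero,
    variance_id_gaussianReal] at h
  simpa using h

lemma ProbabilityTheory.HasLaw.integral_pow_four_gaussianReal_zero {X : Ω → ℝ}
    (hX : HasLaw X (gaussianReal 0 v) P) : ∫ ω, X ω ^ 4 ∂P = 3 * (v : ℝ) ^ 2 := by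
  rw [← integral_pow_four_gaussianReal]
  exact hX.integral_comp (f := fun x => x ^ 4) (by fun_prop)

lemma memLp_two_mul_of_gaussianReal {X Y : Ω → ℝ} (hX : HasLaw X (gaussianReal 0 v) P)
    (hY : HasLaw Y (gaussianReal 0 v) P) : MemLp (fun ω => X ω * Y ω) 2 P := by
  have : ENNReal.HolderTriple 4 4 2 := ⟨by
    rw [← ENNReal.toReal_eq_toReal_iff' (by simp) (by simp),
      ENNReal.toReal_add (by simp) (by simp)]
    norm_num⟩
  exact MemLp.mul' (by simpa using hY.memLp_gaussianReal 4) (by simpa using hX.memLp_gaussianReal 4)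

lemma memLp_two_sum_mul_of_gaussianReal {κ : Type*} [Fintype κ]
    (hlaw : ∀ i, HasLaw (g i) (gaussianReal 0 v) P) (c : κ → ℝ) (e f : κ → ι) :
    MemLp (fun ω => ∑ l, c l * (g (e l) ω * g (f l) ω)) 2 P :=
  memLp_finsetSum _ fun l _ =>
    (memLp_two_mul_of_gaussianReal (hlaw (e l)) (hlaw (f l))).const_mul (c l)

variable [IsProbabilityMeasure P]

lemma integral_mul_of_iIndepFun_gaussianReal [DecidableEq ι] (hg : iIndepFun g P)
    (hlaw : ∀ i, HasLaw (g i) (gaussianReal 0 v) P) (i j : ι) :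
    ∫ ω, g i ω * g j ω ∂P = if i = j then (v : ℝ) else 0 := by
  split_ifs with h
  · subst h
    simpa [sq] using (hlaw i).integral_sq_gaussianReal_zero
  · rw [(hg.indepFun h).integral_fun_mul_eq_mul_integral
      (hlaw i).aemeasurable.aestronglyMeasurable (hlaw j).aemeasurable.aestronglyMeasurable,
      (hlaw i).integral_gaussianReal_zero, zero_mul]

lemma variance_mul_le_of_iIndepFun_gaussianReal (hg : iIndepFun g P)
    (hlaw : ∀ i, HasLaw (g i) (gaussianReal 0 v) P) (i j : ι) :
    Var[fun ω => g i ω * g j ω; P] ≤ 2 * (v : ℝ) ^ 2 := by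
  classical
  rw [variance_eq_sub (memLp_two_mul_of_gaussianReal (hlaw i) (hlaw j)),
    integral_mul_of_iIndepFun_gaussianReal hg hlaw]
  by_cases h : i = j
  · subst h
    have h4 : ∫ ω, ((fun ω => g i ω * g i ω) ^ 2) ω ∂P = 3 * (v : ℝ) ^ 2 := by
      rw [← (hlaw i).integral_pow_four_gaussianReal_zero]
      congr 1 with ω
      simp only [Pi.pow_apply]
      ring
    rw [h4, if_pos rfl]
    linarith
  · have h2 : ∫ ω, ((fun ω => g i ω * g j ω) ^ 2) ω ∂P = (v : ℝ) * v := by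
      simp only [Pi.pow_apply, mul_pow]
      rw [(hg.indepFun h).integral_fun_comp_mul_comp (f := fun x => x ^ 2) (g := fun x => x ^ 2)
        (hlaw i).aemeasurable (hlaw j).aemeasurable (by fun_prop) (by fun_prop),
        (hlaw i).integral_sq_gaussianReal_zero, (hlaw j).integral_sq_gaussianReal_zero]
    rw [h2, if_neg h]
    nlinarith [sq_nonneg (v : ℝ)]

/-- Second moment of a signed sum of products of independent centered Gaussians, different
products involving different variables. -/
lemma integral_sq_sum_mul_le {κ : Type*} [Fintype κ] [DecidableEq ι]
    (hg : iIndepFun g P) (hmeas : ∀ i, Measurable (g i))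
    (hlaw : ∀ i, HasLaw (g i) (gaussianReal 0 v) P) (c : κ → ℝ) (hc : ∀ l, c l ^ 2 = 1)
    (e f : κ → ι) (hee : ∀ l l', l ≠ l' → e l ≠ e l') (hff : ∀ l l', l ≠ l' → f l ≠ f l')
    (hef : ∀ l l', l ≠ l' → e l ≠ f l') :
    ∫ ω, (∑ l, c l * (g (e l) ω * g (f l) ω)) ^ 2 ∂P ≤
      2 * (v : ℝ) ^ 2 * Fintype.card κ + (∑ l, c l * if e l = f l then (v : ℝ) else 0) ^ 2 := by
  have hmem (l : κ) := (memLp_two_mul_of_gaussianReal (hlaw (e l)) (hlaw (f l))).const_mul (c l)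
  have hvar : Var[fun ω => ∑ l, c l * (g (e l) ω * g (f l) ω); P] ≤
      2 * (v : ℝ) ^ 2 * Fintype.card κ := by
    have h := IndepFun.variance_sum (s := Finset.univ) (fun l _ => hmem l) (fun l _ l' _ hl =>
      (hg.indepFun_prodMk_prodMk hmeas (e l) (f l) (e l') (f l') (hee l l' hl) (hef l l' hl)
        (hef l' l hl.symm).symm (hff l l' hl)).comp
        (φ := fun x : ℝ × ℝ => c l * (x.1 * x.2)) (ψ := fun x : ℝ × ℝ => c l' * (x.1 * x.2))
        (by fun_prop) (by fun_prop))
    rw [Finset.sum_fn] at h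
    rw [h]
    calc _ ≤ ∑ _l : κ, 2 * (v : ℝ) ^ 2 := Finset.sum_le_sum fun l _ => by
          rw [variance_const_mul, hc, one_mul]
          exact variance_mul_le_of_iIndepFun_gaussianReal hg hlaw _ _
      _ = _ := by simp [mul_comm]
  rw [variance_eq_sub (memLp_two_sum_mul_of_gaussianReal hlaw c e f),
    integral_finsetSum _ fun l _ => (hmem l).integrable one_le_two] at hvar
  simp_rw [integral_const_mul, integral_mul_of_iIndepFun_gaussianReal hg hlaw] at hvar
  simpa using sub_le_iff_le_add.mp hvar

end Products

section Layers

variable {Ω ι : Type*} {mΩ : MeasurableSpace Ω} {P : Measure Ω}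
  {g : ι → Ω → ℝ} {v : ℝ≥0} {a n b : ℕ}

lemma gram_sub_entry_eq_sum (p : Fin a × Fin n → ι) (q : Fin n × Fin b → ι) (i k : Fin n) (ω : Ω) :
    ∑ l, g (p (l, i)) ω * g (p (l, k)) ω - ∑ m, g (q (i, m)) ω * g (q (k, m)) ω =
      ∑ l : Fin a ⊕ Fin b, (Sum.elim (fun _ => 1) (fun _ => -1) l : ℝ) *
        (g (Sum.elim (fun l => p (l, i)) (fun m => q (i, m)) l) ω *
          g (Sum.elim (fun l => p (l, k)) (fun m => q (k, m)) l) ω) := by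
  simp [sub_eq_add_neg]

lemma integrable_gram_sub_entry_sq (hlaw : ∀ i, HasLaw (g i) (gaussianReal 0 v) P)
    (p : Fin a × Fin n → ι) (q : Fin n × Fin b → ι) (i k : Fin n) :
    Integrable (fun ω => (∑ l, g (p (l, i)) ω * g (p (l, k)) ω -
      ∑ m, g (q (i, m)) ω * g (q (k, m)) ω) ^ 2) P := by
  simp_rw [gram_sub_entry_eq_sum]
  exact (memLp_two_sum_mul_of_gaussianReal hlaw _ _ _).integrable_sq

variable [IsProbabilityMeasure P]

lemma integral_gram_sub_entry_sq_le (hg : iIndepFun g P) (hmeas : ∀ i, Measurable (g i))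
    (hlaw : ∀ i, HasLaw (g i) (gaussianReal 0 v) P)
    {p : Fin a × Fin n → ι} {q : Fin n × Fin b → ι}
    (hp : Function.Injective p) (hq : Function.Injective q) (hne : ∀ x y, p x ≠ q y)
    (i k : Fin n) :
    ∫ ω, (∑ l, g (p (l, i)) ω * g (p (l, k)) ω -
      ∑ m, g (q (i, m)) ω * g (q (k, m)) ω) ^ 2 ∂P ≤
      2 * (v : ℝ) ^ 2 * (a + b) + if i = k then ((a - b) * (v : ℝ)) ^ 2 else 0 := by
  classical
  simp_rw [gram_sub_entry_eq_sum]
  refine (integral_sq_sum_mul_le hg hmeas hlaw _ ?_ _ _ ?_ ?_ ?_).trans_eq ?_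
  · rintro (l | l) <;> simp
  · rintro (l | l) (l' | l') <;> simp [hp.eq_iff, hq.eq_iff, hne, (hne _ _).symm]
  · rintro (l | l) (l' | l') <;> simp [hp.eq_iff, hq.eq_iff, hne, (hne _ _).symm]
  · rintro (l | l) (l' | l') <;> simp +contextual [hp.eq_iff, hq.eq_iff, hne, (hne _ _).symm]
  · by_cases h : i = k <;> simp [hp.eq_iff, hq.eq_iff, h]
    all_goals ring

lemma integral_gram_sub_le (hg : iIndepFun g P) (hmeas : ∀ i, Measurable (g i))
    (hlaw : ∀ i, HasLaw (g i) (gaussianReal 0 v) P)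
    {p : Fin a × Fin n → ι} {q : Fin n × Fin b → ι}
    (hp : Function.Injective p) (hq : Function.Injective q) (hne : ∀ x y, p x ≠ q y)
    {D : ℕ} (ha : a ≤ D) (hn : n ≤ D) (hb : b ≤ D) :
    ∫ ω, ∑ i, ∑ k, (∑ l, g (p (l, i)) ω * g (p (l, k)) ω -
      ∑ m, g (q (i, m)) ω * g (q (k, m)) ω) ^ 2 ∂P ≤ 5 * (v : ℝ) ^ 2 * (D : ℝ) ^ 3 := by
  rw [integral_finsetSum _ fun i _ => integrable_finsetSum _ fun k _ =>
    integrable_gram_sub_entry_sq hlaw p q i k]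
  simp_rw [integral_finsetSum _ fun k _ => integrable_gram_sub_entry_sq hlaw p q _ k]
  have ha' : (a : ℝ) ≤ D := mod_cast ha
  have hb' : (b : ℝ) ≤ D := mod_cast hb
  have hn' : (n : ℝ) ≤ D := mod_cast hn
  have hsq : ((a : ℝ) - b) ^ 2 ≤ (D : ℝ) ^ 2 :=
    sq_le_sq' (by linarith [a.cast_nonneg (α := ℝ)]) (by linarith [b.cast_nonneg (α := ℝ)])
  calc _ ≤ ∑ i : Fin n, ∑ k : Fin n, (2 * (v : ℝ) ^ 2 * (a + b) +
          if i = k then ((a - b) * (v : ℝ)) ^ 2 else 0) :=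
        Finset.sum_le_sum fun i _ => Finset.sum_le_sum fun k _ =>
          integral_gram_sub_entry_sq_le hg hmeas hlaw hp hq hne i k
    _ = (v : ℝ) ^ 2 * (2 * (n : ℝ) ^ 2 * (a + b) + n * (a - b) ^ 2) := by
        simp [Finset.sum_add_distrib]
        ring
    _ ≤ (v : ℝ) ^ 2 * (2 * (D : ℝ) ^ 2 * (D + D) + D * D ^ 2) := by gcongr
    _ = _ := by ring

/-- Markov's inequality for the squared Frobenius norm of the difference of Gram matrices. -/
lemma measure_lt_frobNorm_gram_sub_le (hg : iIndepFun g P) (hmeas : ∀ i, Measurable (g i))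
    (hlaw : ∀ i, HasLaw (g i) (gaussianReal 0 v) P)
    {p : Fin a × Fin n → ι} {q : Fin n × Fin b → ι}
    (hp : Function.Injective p) (hq : Function.Injective q) (hne : ∀ x y, p x ≠ q y)
    {D : ℕ} (ha : a ≤ D) (hn : n ≤ D) (hb : b ≤ D) {δ : ℝ} (hδ : 0 < δ) :
    P {ω | δ < frobNorm ((Matrix.of fun l i => g (p (l, i)) ω)ᵀ *
        (Matrix.of fun l i => g (p (l, i)) ω) -
        (Matrix.of fun i m => g (q (i, m)) ω) * (Matrix.of fun i m => g (q (i, m)) ω)ᵀ)} ≤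
      ENNReal.ofReal (5 * (v : ℝ) ^ 2 * (D : ℝ) ^ 3 / δ ^ 2) := by
  have hint := integral_gram_sub_le hg hmeas hlaw hp hq hne ha hn hb
  have hmarkov := mul_meas_ge_le_integral_of_nonneg
    (f := fun ω => ∑ i, ∑ k, (∑ l, g (p (l, i)) ω * g (p (l, k)) ω -
      ∑ m, g (q (i, m)) ω * g (q (k, m)) ω) ^ 2)
    (ae_of_all P fun ω => by positivity)
    (integrable_finsetSum _ fun i _ => integrable_finsetSum _ fun k _ =>
      integrable_gram_sub_entry_sq hlaw p q i k) (δ ^ 2)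
  refine (measure_mono fun ω hω => ?_).trans
    (ENNReal.le_ofReal_iff_toReal_le (measure_ne_top _ _) (by positivity) |>.mpr
      ((le_div_iff₀' (by positivity)).mpr (hmarkov.trans hint)))
  have h := (Real.lt_sqrt hδ.le).mp hω
  simpa [Matrix.mul_apply] using h.le

end Layers

lemma iIndepFun_eval_sigma_pi {ι : Type*} {κ : ι → Type*} [Fintype ι] [∀ i, Fintype (κ i)]
    (μ : Measure ℝ) [IsProbabilityMeasure μ] :
    iIndepFun (fun (p : (i : ι) × κ i) (ω : ∀ i, κ i → ℝ) => ω p.1 p.2)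
      (Measure.pi fun i => Measure.pi fun _ : κ i => μ) := by
  simpa [Measure.infinitePi_eq_pi] using
    iIndepFun_uncurry_infinitePi (X := fun _ _ x => x) (fun (i : ι) (_ : κ i) => μ)
      (fun _ _ => measurable_id)

lemma hasLaw_eval_sigma_pi {ι : Type*} {κ : ι → Type*} [Fintype ι] [∀ i, Fintype (κ i)]
    (μ : Measure ℝ) [IsProbabilityMeasure μ] (p : (i : ι) × κ i) :
    HasLaw (fun ω : ∀ i, κ i → ℝ => ω p.1 p.2) μ
      (Measure.pi fun i => Measure.pi fun _ : κ i => μ) :=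
  ((measurePreserving_eval (fun _ : κ p.1 => μ) p.2).comp
    (measurePreserving_eval (fun i => Measure.pi fun _ : κ i => μ) p.1)).hasLaw

/-- A consecutive pair of layers fails to be `δ`-balanced with small probability. -/
lemma measure_layer_unbalanced_le {N : ℕ} {d : ℕ → ℕ} (v : ℝ≥0) {D : ℕ}
    (hD : ∀ j ≤ N, d j ≤ D) {δ : ℝ} (hδ : 0 < δ) (j : Fin N) :
    (Measure.pi fun j : Fin N => Measure.pi fun _ : Fin (d (j.1 + 1)) × Fin (d j.1) =>
        gaussianReal 0 v) {ω | ∃ hj : j.1 + 1 < N,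
      δ < frobNorm ((Matrix.of fun i k => ω ⟨j.1 + 1, hj⟩ (i, k))ᵀ *
        (Matrix.of fun i k => ω ⟨j.1 + 1, hj⟩ (i, k)) -
        (Matrix.of fun i k => ω j (i, k)) * (Matrix.of fun i k => ω j (i, k))ᵀ)} ≤
      ENNReal.ofReal (5 * (v : ℝ) ^ 2 * (D : ℝ) ^ 3 / δ ^ 2) := by
  by_cases hj : j.1 + 1 < N
  · simp only [hj, exists_true_left]
    let κ (j : Fin N) := Fin (d (j.1 + 1)) × Fin (d j.1)
    let p : Fin (d (j.1 + 1 + 1)) × Fin (d (j.1 + 1)) → (j : Fin N) × κ j :=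
      Sigma.mk (β := κ) ⟨j.1 + 1, hj⟩
    let q : Fin (d (j.1 + 1)) × Fin (d j.1) → (j : Fin N) × κ j := Sigma.mk (β := κ) j
    refine measure_lt_frobNorm_gram_sub_le (p := p) (q := q)
      (iIndepFun_eval_sigma_pi (κ := κ) _) (fun p => by fun_prop)
      (hasLaw_eval_sigma_pi (κ := κ) _) sigma_mk_injective sigma_mk_injective (fun x y h => ?_)
      (hD _ (by omega)) (hD _ (by omega)) (hD _ (by omega)) hδ
    have := congrArg (fun p => p.1.1) h
    simp [p, q] at this
  · simp [hj]

/-- **Claim**: if the entries of `W_j ∈ ℝ^{d_j × d_{j−1}}`, `j = 1,…,N`, are i.i.d. zero-mean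
Gaussians with standard deviation `s > 0`, then for any `δ > 0` the probability that
`W_1,…,W_N` are `δ`-balanced is at least `max{0, 1 − 10 δ⁻² N s⁴ d_max³}`, where
`d_max = max{d_0,…,d_N}`.  Here the paper's `W_j` is `W (j-1)` (0-indexed), `W j` having
dimensions `d (j+1) × d j`, and the random matrices are modeled by the product of the
entrywise Gaussian product measures. -/
theorem gaussian_init_approximately_balanced
    (N : ℕ) (d : ℕ → ℕ) (s : ℝ) (hs : 0 < s) (δ : ℝ) (hδ : 0 < δ) :
    ENNReal.ofReal (max 0
        (1 - 10 * (N : ℝ) * s ^ 4 * (((Finset.range (N + 1)).sup d : ℕ) : ℝ) ^ 3 / δ ^ 2)) ≤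
      (Measure.pi fun j : Fin N =>
        Measure.pi fun _ : Fin (d (j.1 + 1)) × Fin (d j.1) =>
          gaussianReal 0 (Real.toNNReal (s ^ 2)))
      {ω | ∀ j : ℕ, ∀ hj : j + 1 < N,
        frobNorm ((Matrix.of fun i k => ω ⟨j + 1, hj⟩ (i, k))ᵀ *
              (Matrix.of fun i k => ω ⟨j + 1, hj⟩ (i, k)) -
            (Matrix.of fun i k => ω ⟨j, Nat.lt_of_succ_lt hj⟩ (i, k)) *
              (Matrix.of fun i k => ω ⟨j, Nat.lt_of_succ_lt hj⟩ (i, k))ᵀ) ≤ δ} := by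
  set v : ℝ≥0 := Real.toNNReal (s ^ 2)
  set D := (Finset.range (N + 1)).sup d
  set P : Measure (∀ j : Fin N, Fin (d (j.1 + 1)) × Fin (d j.1) → ℝ) :=
    Measure.pi fun j : Fin N => Measure.pi fun _ : Fin (d (j.1 + 1)) × Fin (d j.1) =>
      gaussianReal 0 v
  have hv : (v : ℝ) = s ^ 2 := Real.coe_toNNReal _ (by positivity)
  have hD (j : ℕ) (hj : j ≤ N) : d j ≤ D :=
    Finset.le_sup (f := d) (Finset.mem_range.mpr (Nat.lt_succ_of_le hj))
  set S : Set (∀ j : Fin N, Fin (d (j.1 + 1)) × Fin (d j.1) → ℝ) := {ω | _}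
  have hlayer (j : Fin N) := measure_layer_unbalanced_le v hD hδ j
  have hcompl : P Sᶜ ≤ ENNReal.ofReal (10 * (N : ℝ) * s ^ 4 * (D : ℝ) ^ 3 / δ ^ 2) := by
    calc P Sᶜ ≤ ∑ _j : Fin N, ENNReal.ofReal (5 * (v : ℝ) ^ 2 * (D : ℝ) ^ 3 / δ ^ 2) := by
          refine (measure_mono fun ω hω => ?_).trans ((measure_iUnion_fintype_le P _).trans
            (Finset.sum_le_sum fun j _ => hlayer j))
          simp only [S, Set.mem_compl_iff, Set.mem_ofPred_eq, not_forall, not_le] at hω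
          obtain ⟨j, hj, h⟩ := hω
          exact Set.mem_iUnion.mpr ⟨⟨j, Nat.lt_of_succ_lt hj⟩, hj, h⟩
      _ = ENNReal.ofReal (N * (5 * (v : ℝ) ^ 2 * (D : ℝ) ^ 3 / δ ^ 2)) := by
          rw [Finset.sum_const, Finset.card_univ, Fintype.card_fin, nsmul_eq_mul,
            ENNReal.ofReal_mul N.cast_nonneg, ENNReal.ofReal_natCast]
      _ ≤ _ := by
          refine ENNReal.ofReal_le_ofReal ?_
          rw [hv, ← mul_div_assoc]
          refine div_le_div_of_nonneg_right ?_ (sq_nonneg δ)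
          have : 0 ≤ (N : ℝ) * s ^ 4 * (D : ℝ) ^ 3 := by positivity
          linarith
  calc _ ≤ 1 - ENNReal.ofReal (10 * (N : ℝ) * s ^ 4 * (D : ℝ) ^ 3 / δ ^ 2) := by
        rw [← ENNReal.ofReal_one, ← ENNReal.ofReal_sub _ (by positivity)]
        exact (ENNReal.ofReal_max _ _).trans_le (by simp)
    _ ≤ P S := by
        rw [tsub_le_iff_right]
        calc 1 = P Set.univ := measure_univ.symm
          _ ≤ P S + P Sᶜ := by
            rw [← Set.union_compl_self S]
            exact measure_union_le _ _
          _ ≤ _ := by gcongr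
end

section
/- Let d ∈ ℕ with d ≥ 20, let a ≥ 1 be a real number, and let Φ ∈ ℝ^d be a vector. Set r = ‖Φ‖₂ / √(ad), and suppose V ∈ ℝ^d is drawn according to the uniform measure on the sphere of radius r centered at the origin. Then with probability at least (3 − 4F(2/√a))/2, V has deficiency margin ‖Φ‖₂/(ad) with respect to Φ, i.e. ‖V − Φ‖₂ ≤ ‖Φ‖₂ − ‖Φ‖₂/(ad). -/
open MeasureTheory Metric

/-- Cumulative distribution function of the standard normal distribution. -/
noncomputable def stdGaussCDF (x : ℝ) : ℝ :=
  (ProbabilityTheory.gaussianReal 0 1 (Set.Iic x)).toReal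

/-- The normalized uniform (Haar) probability measure on the unit sphere in `ℝ^d`,
obtained by normalizing the spherical projection of Lebesgue measure. -/
noncomputable def uniformSphere (d : ℕ) :
    Measure (sphere (0 : EuclideanSpace ℝ (Fin d)) 1) :=
  ((volume : Measure (EuclideanSpace ℝ (Fin d))).toSphere Set.univ)⁻¹ •
    (volume : Measure (EuclideanSpace ℝ (Fin d))).toSphere

/-- The normalized uniform (Haar) probability measure on the sphere of radius `r`
centered at the origin in `ℝ^d`, as a measure on `ℝ^d` (pushforward of the uniform
measure on the unit sphere under scaling by `r`). -/
noncomputable def uniformSphereRadius (d : ℕ) (r : ℝ) :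
    Measure (EuclideanSpace ℝ (Fin d)) :=
  Measure.map (fun x : sphere (0 : EuclideanSpace ℝ (Fin d)) 1 =>
    r • (x : EuclideanSpace ℝ (Fin d))) (uniformSphere d)

/-- Lower bound for the standard normal CDF from `1 - u ^ 2 / 2 ≤ exp (-u ^ 2 / 2)`. -/
theorem half_add_le_stdGaussCDF {y : ℝ} (hy : 0 ≤ y) :
    1 / 2 + (y - y ^ 3 / 6) / Real.sqrt (2 * Real.pi) ≤ stdGaussCDF y := by
  set γ := ProbabilityTheory.gaussianReal 0 1 with hγ
  have hsymm : γ.real (Set.Ici 0) = γ.real (Set.Iic 0) := by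
    have h : γ.map (fun x => -x) = γ := by
      rw [hγ, ProbabilityTheory.gaussianReal_map_neg, neg_zero]
    conv_lhs => rw [← h]
    rw [map_measureReal_apply measurable_neg measurableSet_Ici]
    congr 1
    ext x
    simp
  have hhalf : 1 / 2 ≤ γ.real (Set.Iic 0) := by
    have h := measureReal_union_le (μ := γ) (Set.Iic 0) (Set.Ici 0)
    rw [Set.Iic_union_Ici, probReal_univ, hsymm] at h
    linarith
  have hIoc : (y - y ^ 3 / 6) / Real.sqrt (2 * Real.pi) ≤ γ.real (Set.Ioc 0 y) := by
    have hnn : 0 ≤ ∫ x in Set.Ioc 0 y, ProbabilityTheory.gaussianPDFReal 0 1 x :=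
      integral_nonneg fun x => ProbabilityTheory.gaussianPDFReal_nonneg _ _ x
    rw [measureReal_def, hγ, ProbabilityTheory.gaussianReal_apply_eq_integral 0 one_ne_zero,
      ENNReal.toReal_ofReal hnn, ← intervalIntegral.integral_of_le hy]
    have hint : ∫ u in (0 : ℝ)..y, (Real.sqrt (2 * Real.pi))⁻¹ * (1 - u ^ 2 / 2)
        = (y - y ^ 3 / 6) / Real.sqrt (2 * Real.pi) := by
      rw [intervalIntegral.integral_const_mul, intervalIntegral.integral_sub (by simp)
        (Continuous.intervalIntegrable (by fun_prop) _ _), intervalIntegral.integral_div,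
        integral_pow]
      simp
      ring
    rw [← hint]
    refine intervalIntegral.integral_mono_on hy
      (Continuous.intervalIntegrable (by fun_prop) _ _)
      (ProbabilityTheory.integrable_gaussianPDFReal 0 1).intervalIntegrable fun u _ => ?_
    rw [ProbabilityTheory.gaussianPDFReal_def]
    simp only [NNReal.coe_one, mul_one, sub_zero]
    gcongr
    linarith [Real.add_one_le_exp (-u ^ 2 / 2)]
  have hunion : γ.real (Set.Iic y) = γ.real (Set.Iic 0) + γ.real (Set.Ioc 0 y) := by
    rw [← measureReal_union (Set.Iic_disjoint_Ioc le_rfl) measurableSet_Ioc,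
      Set.Iic_union_Ioc_eq_Iic hy]
  change _ ≤ γ.real (Set.Iic y)
  linarith

theorem monotone_stdGaussCDF : Monotone stdGaussCDF := fun _ _ h =>
  measureReal_mono (Set.Iic_subset_Iic.2 h)

theorem Gamma_add_half_le {x : ℝ} (hx : 0 < x) :
    Real.Gamma (x + 1 / 2) ≤ Real.sqrt x * Real.Gamma x := by
  have h := Real.Gamma_mul_add_mul_le_rpow_Gamma_mul_rpow_Gamma hx (by linarith : 0 < x + 1)
    one_half_pos one_half_pos (by norm_num)
  have hΓ := (Real.Gamma_pos_of_pos hx).le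
  rw [Real.Gamma_add_one hx.ne', ← Real.sqrt_eq_rpow, ← Real.sqrt_eq_rpow,
    Real.sqrt_mul hx.le, mul_left_comm, Real.mul_self_sqrt hΓ] at h
  convert h using 2
  ring

/-- Comparison of the volumes of unit balls in consecutive dimensions. -/
theorem volume_ball_le_mul_volume_ball_succ (n : ℕ) [NeZero n] :
    volume (ball (0 : EuclideanSpace ℝ (Fin n)) 1) ≤
      ENNReal.ofReal (Real.sqrt ((n + 2) / (2 * Real.pi))) *
        volume (ball (0 : EuclideanSpace ℝ (Fin (n + 1))) 1) := by
  rw [EuclideanSpace.volume_ball, EuclideanSpace.volume_ball]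
  simp only [Fintype.card_fin, ENNReal.ofReal_one, one_pow, one_mul]
  rw [← ENNReal.ofReal_mul (Real.sqrt_nonneg _)]
  apply ENNReal.ofReal_le_ofReal
  have hx : (0 : ℝ) < n / 2 + 1 := by positivity
  have h := Gamma_add_half_le hx
  have hπ : 0 < Real.sqrt Real.pi := Real.sqrt_pos.2 Real.pi_pos
  have h1 := Real.Gamma_pos_of_pos hx
  have h2 := Real.Gamma_pos_of_pos (by linarith : (0 : ℝ) < n / 2 + 1 + 1 / 2)
  have e1 : ((n + 1 : ℕ) : ℝ) / 2 + 1 = n / 2 + 1 + 1 / 2 := by push_cast; ring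
  have e2 : ((n : ℝ) + 2) / (2 * Real.pi) = (n / 2 + 1) / Real.pi := by field_simp
  rw [e1, e2, Real.sqrt_div hx.le, pow_succ, div_mul_div_comm, div_le_div_iff₀ h1 (by positivity)]
  have := mul_le_mul_of_nonneg_left h (by positivity : 0 ≤ √Real.pi ^ n * √Real.pi)
  linarith

theorem volume_coordinate_slab_le (n : ℕ) (s : ℝ) :
    volume {x : EuclideanSpace ℝ (Fin (n + 1)) | ‖x‖ < 1 ∧ 0 ≤ x 0 ∧ x 0 ≤ s} ≤
      ENNReal.ofReal s * volume (ball (0 : EuclideanSpace ℝ (Fin n)) 1) := by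
  set e := MeasurableEquiv.piFinSuccAbove (fun _ : Fin (n + 1) => ℝ) 0
  have he : MeasurePreserving (fun x : EuclideanSpace ℝ (Fin (n + 1)) =>
      ((e x.ofLp).1, WithLp.toLp 2 (e x.ofLp).2)) volume
      ((volume : Measure ℝ).prod (volume : Measure (EuclideanSpace ℝ (Fin n)))) :=
    ((MeasurePreserving.id volume).prod (PiLp.volume_preserving_toLp (Fin n))).comp
      ((volume_preserving_piFinSuccAbove (fun _ : Fin (n + 1) => ℝ) 0).comp
        (PiLp.volume_preserving_ofLp (Fin (n + 1))))
  calc _ ≤ volume ((fun x : EuclideanSpace ℝ (Fin (n + 1)) =>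
      ((e x.ofLp).1, WithLp.toLp 2 (e x.ofLp).2)) ⁻¹' (Set.Icc 0 s ×ˢ ball 0 1)) := by
        refine measure_mono fun x ⟨hx, h0, hs⟩ => ⟨⟨h0, hs⟩, ?_⟩
        rw [mem_ball_zero_iff]
        refine lt_of_le_of_lt ?_ hx
        rw [EuclideanSpace.norm_eq, EuclideanSpace.norm_eq]
        apply Real.sqrt_le_sqrt
        rw [Fin.sum_univ_succ (n := n)]
        exact le_add_of_nonneg_left (sq_nonneg _)
    _ = _ := by
        rw [he.measure_preimage (measurableSet_Icc.prod measurableSet_ball).nullMeasurableSet,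
          Measure.prod_prod, Real.volume_Icc, sub_zero]

theorem volume_slab_le (n : ℕ) (s : ℝ) {w : EuclideanSpace ℝ (Fin (n + 1))} (hw : ‖w‖ = 1) :
    volume {x : EuclideanSpace ℝ (Fin (n + 1)) | ‖x‖ < 1 ∧ 0 ≤ inner ℝ w x ∧ inner ℝ w x ≤ s} ≤
      ENNReal.ofReal s * volume (ball (0 : EuclideanSpace ℝ (Fin n)) 1) := by
  set v : EuclideanSpace ℝ (Fin (n + 1)) := EuclideanSpace.single 0 1 with hv
  have hvw : ‖v‖ = ‖w‖ := by simp [hv, hw]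
  set R := Submodule.reflection (Submodule.span ℝ {v - w})ᗮ
  have hR : R v = w := Submodule.reflection_sub hvw
  refine le_trans (le_of_eq ?_) (volume_coordinate_slab_le n s)
  rw [← R.measurePreserving.measure_preimage_equiv
    (f := R.toHomeomorph.toMeasurableEquiv)]
  congr 1
  ext x
  have : inner ℝ w (R x) = x 0 := by
    rw [← hR, R.inner_map_map, hv, EuclideanSpace.inner_single_left]
    simp
  change (‖R x‖ < 1 ∧ 0 ≤ inner ℝ w (R x) ∧ inner ℝ w (R x) ≤ s) ↔ _
  rw [this, R.norm_map]
  rfl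

/-- At least half of the unit ball, up to a slab, lies in the cone `s * ‖x‖ ≤ ⟪w, x⟫`. -/
theorem volume_ball_le_two_mul_cone_add_slab {d : ℕ} (s : ℝ) (hs : 0 ≤ s)
    (w : EuclideanSpace ℝ (Fin d)) :
    volume (ball (0 : EuclideanSpace ℝ (Fin d)) 1) ≤
      2 * (volume {x : EuclideanSpace ℝ (Fin d) | x ≠ 0 ∧ ‖x‖ < 1 ∧ s * ‖x‖ ≤ inner ℝ w x} +
        volume {x : EuclideanSpace ℝ (Fin d) | ‖x‖ < 1 ∧ 0 ≤ inner ℝ w x ∧ inner ℝ w x ≤ s}) := by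
  set G := {x : EuclideanSpace ℝ (Fin d) | x ≠ 0 ∧ ‖x‖ < 1 ∧ s * ‖x‖ ≤ inner ℝ w x}
  set H := {x : EuclideanSpace ℝ (Fin d) | ‖x‖ < 1 ∧ 0 ≤ inner ℝ w x ∧ inner ℝ w x ≤ s}
  have hGH : {x : EuclideanSpace ℝ (Fin d) | ‖x‖ < 1 ∧ 0 ≤ inner ℝ w x} ⊆ G ∪ H := by
    rintro x ⟨hx, h0⟩
    by_cases h : inner ℝ w x ≤ s
    · exact Or.inr ⟨hx, h0, h⟩
    · push Not at h
      refine Or.inl ⟨?_, hx, (mul_le_of_le_one_right hs hx.le).trans h.le⟩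
      rintro rfl
      rw [inner_zero_right] at h
      linarith
  have hneg : volume {x : EuclideanSpace ℝ (Fin d) | ‖x‖ < 1 ∧ inner ℝ w x ≤ 0} =
      volume {x : EuclideanSpace ℝ (Fin d) | ‖x‖ < 1 ∧ 0 ≤ inner ℝ w x} := by
    rw [← Measure.measure_neg]
    congr 1
    ext x
    simp
  have hcover : ball (0 : EuclideanSpace ℝ (Fin d)) 1 ⊆
      {x | ‖x‖ < 1 ∧ 0 ≤ inner ℝ w x} ∪ {x | ‖x‖ < 1 ∧ inner ℝ w x ≤ 0} := fun x hx => by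
    rw [mem_ball_zero_iff] at hx
    exact (le_total 0 (inner ℝ w x)).imp (fun h => ⟨hx, h⟩) (fun h => ⟨hx, h⟩)
  refine (measure_mono hcover).trans ((measure_union_le _ _).trans ?_)
  rw [hneg, ← two_mul]
  gcongr
  exact (measure_mono hGH).trans (measure_union_le _ _)

/-- The uniform measure of a subset of the sphere is at least the proportion of the unit ball
occupied by any set of points whose radial projection lies in that subset. -/
theorem div_volume_ball_le_uniformSphere {d : ℕ} [NeZero d]
    {S : Set (sphere (0 : EuclideanSpace ℝ (Fin d)) 1)} (hS : MeasurableSet S)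
    {G : Set (EuclideanSpace ℝ (Fin d))}
    (hG : ∀ x ∈ G, x ≠ 0 ∧ ‖x‖ < 1 ∧ ∃ u ∈ S, x = ‖x‖ • (u : EuclideanSpace ℝ (Fin d))) :
    volume G / volume (ball (0 : EuclideanSpace ℝ (Fin d)) 1) ≤ uniformSphere d S := by
  have hd : ((Module.finrank ℝ (EuclideanSpace ℝ (Fin d)) : ℕ) : ENNReal) ≠ 0 := by
    simp [NeZero.ne d]
  rw [uniformSphere, Measure.smul_apply, Measure.toSphere_apply_univ, Measure.toSphere_apply' _ hS,
    smul_eq_mul, ENNReal.mul_inv (Or.inl hd) (Or.inl (ENNReal.natCast_ne_top _)),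
    mul_mul_mul_comm, ENNReal.inv_mul_cancel hd (ENNReal.natCast_ne_top _), one_mul, mul_comm,
    ← div_eq_mul_inv]
  gcongr
  intro x hx
  obtain ⟨h0, h1, u, hu, hxu⟩ := hG x hx
  rw [hxu]
  exact Set.smul_mem_smul ⟨norm_pos_iff.2 h0, h1⟩ (Set.mem_image_of_mem _ hu)

/-- A lower bound for the uniform measure of a spherical cap. -/
theorem half_sub_le_uniformSphere_cap (n : ℕ) [NeZero n] {s : ℝ} (hs : 0 ≤ s)
    {w : EuclideanSpace ℝ (Fin (n + 1))} (hw : ‖w‖ = 1) :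
    ENNReal.ofReal (1 / 2 - s * Real.sqrt ((n + 2) / (2 * Real.pi))) ≤
      uniformSphere (n + 1) {u | s ≤ inner ℝ w (u : EuclideanSpace ℝ (Fin (n + 1)))} := by
  set B := volume (ball (0 : EuclideanSpace ℝ (Fin (n + 1))) 1)
  set ρ := Real.sqrt ((n + 2) / (2 * Real.pi))
  set G := {x : EuclideanSpace ℝ (Fin (n + 1)) | x ≠ 0 ∧ ‖x‖ < 1 ∧ s * ‖x‖ ≤ inner ℝ w x}
  have hB0 : B ≠ 0 := (measure_ball_pos _ _ one_pos).ne'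
  have hBt : B ≠ ⊤ := measure_ball_lt_top.ne
  have hmeas : MeasurableSet {u : sphere (0 : EuclideanSpace ℝ (Fin (n + 1))) 1 |
      s ≤ inner ℝ w (u : EuclideanSpace ℝ (Fin (n + 1)))} :=
    (isClosed_le (by fun_prop) (by fun_prop)).measurableSet
  refine le_trans ?_ (div_volume_ball_le_uniformSphere hmeas (G := G) ?_)
  · have h := volume_ball_le_two_mul_cone_add_slab s hs w
    have h2 : B ≤ 2 * (volume G + ENNReal.ofReal (s * ρ) * B) := by
      refine h.trans ?_
      gcongr
      refine (volume_slab_le n s hw).trans ?_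
      rw [ENNReal.ofReal_mul hs, mul_assoc]
      gcongr
      exact volume_ball_le_mul_volume_ball_succ n
    have hGt : volume G ≠ ⊤ :=
      ne_top_of_le_ne_top hBt (measure_mono fun x hx => mem_ball_zero_iff.2 hx.2.1)
    rw [ENNReal.le_div_iff_mul_le (Or.inl hB0) (Or.inl hBt)]
    rw [← ENNReal.ofReal_toReal hBt, ← ENNReal.ofReal_toReal hGt,
      ← ENNReal.ofReal_mul (by positivity),
      ← ENNReal.ofReal_add (by positivity) (by positivity), two_mul,
      ← ENNReal.ofReal_add (by positivity) (by positivity), ENNReal.ofReal_le_ofReal_iff (by positivity)] at h2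
    rw [← ENNReal.ofReal_toReal hBt, ← ENNReal.ofReal_toReal hGt,
      ← ENNReal.ofReal_mul' (by positivity)]
    apply ENNReal.ofReal_le_ofReal
    linarith
  · rintro x ⟨h0, h1, h2⟩
    have hx : 0 < ‖x‖ := norm_pos_iff.2 h0
    refine ⟨h0, h1, ⟨‖x‖⁻¹ • x, ?_⟩, ?_, ?_⟩
    · rw [mem_sphere_zero_iff_norm, norm_smul, norm_inv, norm_norm, inv_mul_cancel₀ hx.ne']
    · change s ≤ inner ℝ w (‖x‖⁻¹ • x)
      rw [inner_smul_right, inv_mul_eq_div, le_div_iff₀ hx]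
      exact h2
    · change x = ‖x‖ • ‖x‖⁻¹ • x
      rw [smul_smul, mul_inv_cancel₀ hx.ne', one_smul]

theorem norm_smul_sub_le_of_le_inner {E : Type*} [NormedAddCommGroup E] [InnerProductSpace ℝ E]
    {u Φ : E} (hu : ‖u‖ = 1) {q : ℝ} (hq : 1 ≤ q)
    (h : 3 / 2 / Real.sqrt q * ‖Φ‖ ≤ inner ℝ Φ u) :
    ‖(‖Φ‖ / Real.sqrt q) • u - Φ‖ ≤ ‖Φ‖ - ‖Φ‖ / q := by
  have hq0 : 0 < q := by linarith
  obtain ⟨p, hp, rfl⟩ : ∃ p : ℝ, 0 < p ∧ q = p ^ 2 :=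
    ⟨√q, Real.sqrt_pos.2 hq0, (Real.sq_sqrt hq0.le).symm⟩
  rw [Real.sqrt_sq hp.le] at *
  have hnn : 0 ≤ ‖Φ‖ - ‖Φ‖ / p ^ 2 := sub_nonneg.2 (div_le_self (norm_nonneg _) hq)
  refine (sq_le_sq₀ (norm_nonneg _) hnn).1 ?_
  have h' := mul_le_mul_of_nonneg_left h (by positivity : 0 ≤ 2 * (‖Φ‖ / p))
  rw [norm_sub_sq_real, real_inner_smul_left, norm_smul, hu, mul_one, Real.norm_eq_abs, sq_abs,
    real_inner_comm]
  have e : 2 * (‖Φ‖ / p) * (3 / 2 / p * ‖Φ‖) = 3 * (‖Φ‖ / p) ^ 2 := by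
    field_simp
  have e' : (‖Φ‖ - ‖Φ‖ / p ^ 2) ^ 2 = ‖Φ‖ ^ 2 - 2 * (‖Φ‖ / p) ^ 2 + (‖Φ‖ / p ^ 2) ^ 2 := by
    field_simp
    ring
  rw [e] at h'
  rw [e']
  linarith [sq_nonneg (‖Φ‖ / p ^ 2)]

/-- **Lemma**: let `d ≥ 20`, `a ≥ 1`, `Φ ∈ ℝ^d`, and `r = ‖Φ‖₂/√(ad)`.  If `V` is drawn
uniformly from the sphere of radius `r` centered at the origin, then with probability at
least `(3 − 4F(2/√a))/2`, `V` has deficiency margin `‖Φ‖₂/(ad)` with respect to `Φ`,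
i.e. `‖V − Φ‖₂ ≤ ‖Φ‖₂ − ‖Φ‖₂/(ad)`. -/
theorem uniform_sphere_deficiency_margin
    (d : ℕ) (hd : 20 ≤ d) (a : ℝ) (ha : 1 ≤ a) (Φ : EuclideanSpace ℝ (Fin d)) :
    ENNReal.ofReal ((3 - 4 * stdGaussCDF (2 / Real.sqrt a)) / 2) ≤
      uniformSphereRadius d (‖Φ‖ / Real.sqrt (a * (d : ℝ)))
        {V : EuclideanSpace ℝ (Fin d) | ‖V - Φ‖ ≤ ‖Φ‖ - ‖Φ‖ / (a * (d : ℝ))} := by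
  obtain ⟨n, rfl⟩ : ∃ n, d = n + 1 := ⟨d - 1, by omega⟩
  have : NeZero n := ⟨by omega⟩
  have hn : (19 : ℝ) ≤ n := by exact_mod_cast (by omega : 19 ≤ n)
  set q : ℝ := a * ((n + 1 : ℕ) : ℝ) with hq_def
  have hq : 1 ≤ q := by
    rw [hq_def]; push_cast; nlinarith
  set y : ℝ := 2 / Real.sqrt a with hy_def
  have ha0 : 0 < Real.sqrt a := Real.sqrt_pos.2 (by linarith)
  have hy : 0 < y := by positivity
  have hF := half_add_le_stdGaussCDF hy.le
  rw [uniformSphereRadius, Measure.map_apply (by fun_prop)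
    (isClosed_le (by fun_prop) (by fun_prop)).measurableSet]
  obtain ⟨w, hw, hΦ⟩ : ∃ w : EuclideanSpace ℝ (Fin (n + 1)), ‖w‖ = 1 ∧ Φ = ‖Φ‖ • w := by
    by_cases h : Φ = 0
    · exact ⟨EuclideanSpace.single 0 1, by simp, by simp [h]⟩
    · have hpos := norm_pos_iff.2 h
      refine ⟨‖Φ‖⁻¹ • Φ, ?_, ?_⟩
      · rw [norm_smul, norm_inv, norm_norm, inv_mul_cancel₀ hpos.ne']
      · rw [smul_smul, mul_inv_cancel₀ hpos.ne', one_smul]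
  have hcap := half_sub_le_uniformSphere_cap n (s := 3 / 2 / Real.sqrt q) (by positivity) hw
  refine le_trans ?_ (hcap.trans (measure_mono fun u hu => ?_))
  · have h2π : 0 < Real.sqrt (2 * Real.pi) := by positivity
    rcases le_total 1 y with h1 | h1
    · have hmono : stdGaussCDF 1 ≤ stdGaussCDF y := monotone_stdGaussCDF h1
      have hF1 := half_add_le_stdGaussCDF zero_le_one
      have hπ : Real.sqrt (2 * Real.pi) ≤ 10 / 3 := by
        rw [Real.sqrt_le_left (by norm_num)]
        linarith [Real.pi_lt_d2]
      have : 1 / 4 ≤ (1 - 1 ^ 3 / 6) / Real.sqrt (2 * Real.pi) := by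
        rw [le_div_iff₀ h2π]
        linarith
      rw [ENNReal.ofReal_of_nonpos (by linarith)]
      exact zero_le
    · apply ENNReal.ofReal_le_ofReal
      have hratio : Real.sqrt (n + 2) ≤ 103 / 100 * Real.sqrt (n + 1) := by
        rw [Real.sqrt_le_left (by positivity), mul_pow, Real.sq_sqrt (by positivity)]
        linarith
      have hn1 : 0 < Real.sqrt (n + 1 : ℝ) := by positivity
      have hs : 3 / 2 / Real.sqrt q * Real.sqrt ((n + 2) / (2 * Real.pi)) ≤
          309 / 400 * y / Real.sqrt (2 * Real.pi) := by
        rw [Real.sqrt_div (by positivity), ← mul_div_assoc]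
        refine div_le_div_of_nonneg_right ?_ h2π.le
        rw [hq_def, Real.sqrt_mul (by linarith), Nat.cast_add_one, hy_def, div_mul_eq_mul_div,
          div_le_iff₀ (by positivity)]
        have e : 309 / 400 * (2 / Real.sqrt a) * (Real.sqrt a * Real.sqrt (n + 1)) =
            309 / 200 * Real.sqrt (n + 1) := by
          field_simp
          norm_num
        rw [e]
        linarith
      have hcmp : 309 / 400 * y / Real.sqrt (2 * Real.pi) ≤
          2 * ((y - y ^ 3 / 6) / Real.sqrt (2 * Real.pi)) := by
        rw [← mul_div_assoc 2 (y - y ^ 3 / 6)]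
        refine div_le_div_of_nonneg_right ?_ h2π.le
        nlinarith [pow_le_of_le_one hy.le h1 (three_ne_zero)]
      linarith
  · refine norm_smul_sub_le_of_le_inner (mem_sphere_zero_iff_norm.1 u.2) hq ?_
    have hin : inner ℝ Φ (u : EuclideanSpace ℝ (Fin (n + 1))) = ‖Φ‖ * inner ℝ w u := by
      conv_lhs => rw [hΦ]
      rw [real_inner_smul_left]
    rw [hin, mul_comm]
    exact mul_le_mul_of_nonneg_left hu (norm_nonneg _)
end

section
/- Let d ∈ ℕ with d ≥ 20, let b₂ > b₁ ≥ 1 be real numbers, and let Φ ∈ ℝ^d be a vector. Suppose μ is a rotation-invariant probability distribution over ℝ^d with a well-defined density, such that for some 0 < ε < 1, P_{V∼μ}[ ‖Φ‖₂/√(b₂ d) ≤ ‖V‖₂ ≤ ‖Φ‖₂/√(b₁ d) ] ≥ 1 − ε. Then, with probability at least (1 − ε) · (3 − 4F(2/√(b₁)))/2, V has deficiency margin ‖Φ‖₂/(b₂ d) with respect to Φ, i.e. ‖V − Φ‖₂ ≤ ‖Φ‖₂ − ‖Φ‖₂/(b₂ d). -/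
open MeasureTheory

open ProbabilityTheory
open scoped RealInnerProductSpace

lemma gaussianReal_abs_le_le (M : ℝ) :
    gaussianReal 0 1 {t | |t| ≤ M} ≤ ENNReal.ofReal (2 * M / √(2 * Real.pi)) := by
  rw [gaussianReal_apply _ one_ne_zero]
  have hset : {t : ℝ | |t| ≤ M} = Set.Icc (-M) M := by ext t; simp [abs_le]
  calc ∫⁻ x in {t | |t| ≤ M}, gaussianPDF 0 1 x
      ≤ ∫⁻ _ in {t : ℝ | |t| ≤ M}, ENNReal.ofReal ((√(2 * Real.pi))⁻¹) := by
        refine lintegral_mono fun x ↦ ENNReal.ofReal_le_ofReal ?_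
        simp only [gaussianPDFReal, NNReal.coe_one, mul_one]
        refine mul_le_of_le_one_right (by positivity) (Real.exp_le_one_iff.2 ?_)
        rw [neg_div, Left.neg_nonpos_iff]
        positivity
    _ = ENNReal.ofReal (2 * M / √(2 * Real.pi)) := by
        rw [hset, setLIntegral_const, Real.volume_Icc, ← ENNReal.ofReal_mul (by positivity)]
        congr 1
        ring

lemma le_gaussianReal_Icc {w : ℝ} (hw0 : 0 ≤ w) (hw1 : w ≤ 1) :
    5 / 3 * w / √(2 * Real.pi) ≤ (gaussianReal 0 1).real (Set.Icc (-w) w) := by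
  rw [measureReal_def, gaussianReal_apply_eq_integral _ one_ne_zero,
    ENNReal.toReal_ofReal (integral_nonneg fun x ↦ gaussianPDFReal_nonneg _ _ _),
    integral_Icc_eq_integral_Ioc, ← intervalIntegral.integral_of_le (by linarith)]
  calc 5 / 3 * w / √(2 * Real.pi)
      ≤ (√(2 * Real.pi))⁻¹ * (2 * w - w ^ 3 / 3) := by
        rw [div_eq_inv_mul]
        gcongr
        nlinarith [mul_nonneg hw0 (by nlinarith : (0 : ℝ) ≤ 1 - w ^ 2)]
    _ = ∫ x in (-w)..w, (√(2 * Real.pi))⁻¹ * (1 - x ^ 2 / 2) := by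
        rw [intervalIntegral.integral_const_mul, intervalIntegral.integral_sub (by simp)
          (Continuous.intervalIntegrable (by fun_prop) _ _)]
        simp only [intervalIntegral.integral_div, integral_pow, intervalIntegral.integral_const,
          smul_eq_mul]
        norm_num
        left
        ring
    _ ≤ ∫ x in (-w)..w, gaussianPDFReal 0 1 x := by
        refine intervalIntegral.integral_mono_on (by linarith)
          (Continuous.intervalIntegrable (by fun_prop) _ _)
          (integrable_gaussianPDFReal 0 1).intervalIntegrable fun x _ ↦ ?_
        simp only [gaussianPDFReal, NNReal.coe_one, mul_one, sub_zero]
        gcongr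
        linarith [Real.add_one_le_exp (-x ^ 2 / 2)]

lemma le_two_mul_stdGaussCDF {w : ℝ} (hw0 : 0 ≤ w) (hw1 : w ≤ 1) :
    1 + 5 / 3 * w / √(2 * Real.pi) ≤ 2 * stdGaussCDF w := by
  have hcdf : stdGaussCDF w = (gaussianReal 0 1).real (Set.Iic w) := rfl
  have hsymm : (gaussianReal 0 1).real (Set.Ici (-w)) = (gaussianReal 0 1).real (Set.Iic w) := by
    have h := gaussianReal_map_neg (μ := 0) (v := 1)
    rw [neg_zero] at h
    conv_lhs => rw [← h]
    rw [map_measureReal_apply measurable_neg measurableSet_Ici]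
    congr 1
    ext x
    simp
  have hunion := measureReal_union_add_inter (μ := gaussianReal 0 1) (s := Set.Iic w)
    (t := Set.Ici (-w)) measurableSet_Ici
  rw [Set.Iic_union_Ici_of_le (by linarith), Set.Iic_inter_Ici, probReal_univ, hsymm] at hunion
  linarith [le_gaussianReal_Icc hw0 hw1]

lemma lintegral_sum_sq_pi_gaussianReal (n : ℕ) :
    ∫⁻ z : Fin n → ℝ, ENNReal.ofReal (∑ i, z i ^ 2) ∂(Measure.pi fun _ ↦ gaussianReal 0 1) = n := by
  have hsq : ∫⁻ x, ENNReal.ofReal (x ^ 2) ∂(gaussianReal 0 1) = 1 := by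
    have hint : Integrable (fun x : ℝ ↦ x ^ 2) (gaussianReal 0 1) :=
      (memLp_id_gaussianReal 2).integrable_sq
    rw [← ofReal_integral_eq_lintegral_ofReal hint
      (Filter.Eventually.of_forall fun x ↦ sq_nonneg x)]
    have h := variance_fun_id_gaussianReal (μ := 0) (v := 1)
    rw [variance_eq_integral (by fun_prop)] at h
    simp at h
    simp [h]
  simp_rw [ENNReal.ofReal_sum_of_nonneg fun i _ ↦ sq_nonneg _]
  rw [lintegral_finsetSum _ (by fun_prop)]
  have (i : Fin n) : ∫⁻ z : Fin n → ℝ, ENNReal.ofReal (z i ^ 2)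
      ∂(Measure.pi fun _ ↦ gaussianReal 0 1) = 1 := by
    rw [← hsq]
    exact (measurePreserving_eval (fun _ : Fin n ↦ gaussianReal 0 1) i).lintegral_comp
      (f := fun x : ℝ ↦ ENNReal.ofReal (x ^ 2)) (by fun_prop)
  simp [this]

lemma pi_gaussianReal_head_le {n : ℕ} (hn : 0 < n) {a : ℝ} (ha : 0 ≤ a) :
    Measure.pi (fun _ : Fin (n + 1) ↦ gaussianReal 0 1)
      {y | n * y 0 ^ 2 ≤ a ^ 2 * ∑ i : Fin n, y i.succ ^ 2} ≤
      ENNReal.ofReal (2 * a / √(2 * Real.pi)) := by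
  have hn' : (0 : ℝ) < n := by exact_mod_cast hn
  set ν := Measure.pi (fun _ : Fin n ↦ gaussianReal 0 1)
  set S : Set (ℝ × (Fin n → ℝ)) := {p | n * p.1 ^ 2 ≤ a ^ 2 * ∑ i, p.2 i ^ 2}
  have hS : MeasurableSet S := measurableSet_le (by fun_prop) (by fun_prop)
  have hmp := measurePreserving_piFinSuccAbove (fun _ : Fin (n + 1) ↦ gaussianReal 0 1) 0
  have hpre : {y : Fin (n + 1) → ℝ | n * y 0 ^ 2 ≤ a ^ 2 * ∑ i : Fin n, y i.succ ^ 2} =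
      MeasurableEquiv.piFinSuccAbove (fun _ ↦ ℝ) 0 ⁻¹' S := by
    ext y
    simp [S, MeasurableEquiv.piFinSuccAbove, Fin.insertNthEquiv, Fin.tail]
  rw [hpre, hmp.measure_preimage hS.nullMeasurableSet, Measure.prod_apply_symm hS]
  calc ∫⁻ z, gaussianReal 0 1 ((fun t ↦ (t, z)) ⁻¹' S) ∂ν
      ≤ ∫⁻ z, ENNReal.ofReal (a / √(2 * Real.pi) / n) * ENNReal.ofReal (∑ i, z i ^ 2) +
          ENNReal.ofReal (a / √(2 * Real.pi)) ∂ν := by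
        refine lintegral_mono fun z ↦ ?_
        set q := ∑ i, z i ^ 2 with hq
        have hq0 : 0 ≤ q := Finset.sum_nonneg fun i _ ↦ sq_nonneg _
        have hsub : (fun t ↦ (t, z)) ⁻¹' S ⊆ {t | |t| ≤ a * (q / n + 1) / 2} := by
          intro t ht
          have ht' : n * t ^ 2 ≤ a ^ 2 * q := ht
          refine abs_le_of_sq_le_sq (a := t) ?_ (by positivity)
          have h1 : t ^ 2 ≤ a ^ 2 * (q / n) := by
            rw [mul_div_assoc', le_div_iff₀ hn']; linarith
          nlinarith [mul_nonneg (sq_nonneg a) (sq_nonneg (q / n - 1))]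
        refine (measure_mono hsub).trans ((gaussianReal_abs_le_le _).trans_eq ?_)
        rw [← ENNReal.ofReal_mul (by positivity), ← ENNReal.ofReal_add (by positivity)
          (by positivity)]
        congr 1
        field_simp
    _ = ENNReal.ofReal (2 * a / √(2 * Real.pi)) := by
        rw [lintegral_add_right _ (by fun_prop), lintegral_const_mul _ (by fun_prop),
          lintegral_sum_sq_pi_gaussianReal, lintegral_const, measure_univ, mul_one,
          ← ENNReal.ofReal_natCast n, ← ENNReal.ofReal_mul (by positivity),
          ← ENNReal.ofReal_add (by positivity) (by positivity)]
        congr 1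
        field_simp
        ring

lemma le_stdGaussian_head {n : ℕ} (hn : 0 < n) {a c : ℝ} (ha : 0 ≤ a) (ha1 : a ≤ 1)
    (hc : c ^ 2 * (n + 1) = a ^ 2) :
    ENNReal.ofReal (1 / 2 - a / √(2 * Real.pi)) ≤
      stdGaussian (EuclideanSpace ℝ (Fin (n + 1))) {y | c * ‖y‖ ≤ y 0} := by
  set γ := stdGaussian (EuclideanSpace ℝ (Fin (n + 1))) with hγ
  set A := {y : EuclideanSpace ℝ (Fin (n + 1)) | c * ‖y‖ ≤ y 0}
  set A' := {y : EuclideanSpace ℝ (Fin (n + 1)) | c * ‖y‖ ≤ -y 0}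
  set B := {y : EuclideanSpace ℝ (Fin (n + 1)) | |y 0| ≤ c * ‖y‖}
  have hA : MeasurableSet A := measurableSet_le (by fun_prop) (by fun_prop)
  have hB : MeasurableSet B := measurableSet_le (by fun_prop) (by fun_prop)
  have hA' : γ A' = γ A := by
    rw [hγ, ← stdGaussian_map (LinearIsometryEquiv.neg ℝ
      (E := EuclideanSpace ℝ (Fin (n + 1)))), Measure.map_apply (by fun_prop) hA,
      stdGaussian_map]
    congr 1
    ext y
    simp [A, A']
  have hBle : γ B ≤ ENNReal.ofReal (2 * a / √(2 * Real.pi)) := by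
    rw [hγ, ← map_pi_eq_stdGaussian, Measure.map_apply (by fun_prop) hB]
    refine (measure_mono fun y hy ↦ ?_).trans (pi_gaussianReal_head_le hn ha)
    have hy' : |y 0| ≤ c * ‖WithLp.toLp 2 y‖ := hy
    have hsq : y 0 ^ 2 ≤ c ^ 2 * ∑ i, y i ^ 2 := by
      have := pow_le_pow_left₀ (abs_nonneg _) hy' 2
      rwa [sq_abs, mul_pow, EuclideanSpace.real_norm_sq_eq] at this
    rw [Fin.sum_univ_succ] at hsq
    set q := ∑ i : Fin n, y i.succ ^ 2
    change n * y 0 ^ 2 ≤ a ^ 2 * q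
    have hscaled : (n + 1) * y 0 ^ 2 ≤ a ^ 2 * (y 0 ^ 2 + q) := by
      rw [← hc]
      linarith [mul_le_mul_of_nonneg_left hsq (by positivity : (0 : ℝ) ≤ n + 1)]
    nlinarith [mul_nonneg (by nlinarith : (0 : ℝ) ≤ 1 - a ^ 2) (sq_nonneg (y 0)),
      hscaled]
  have hcover : (1 : ENNReal) ≤ γ A + γ A + γ B := by
    calc (1 : ENNReal) = γ Set.univ := measure_univ.symm
      _ ≤ γ (A ∪ A' ∪ B) := measure_mono fun y _ ↦ by
          by_cases h : |y 0| ≤ c * ‖y‖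
          · exact Or.inr h
          · exact Or.inl ((le_abs.1 (not_le.1 h).le))
      _ ≤ γ A + γ A' + γ B :=
          (measure_union_le _ _).trans (add_le_add_left (measure_union_le _ _) _)
      _ = _ := by rw [hA']
  have hreal : (1 : ℝ) ≤ γ.real A + γ.real A + 2 * a / √(2 * Real.pi) := by
    have h := hcover.trans (add_le_add_right hBle _)
    rw [← ofReal_measureReal, ← ENNReal.ofReal_add (by positivity) (by positivity),
      ← ENNReal.ofReal_add (by positivity) (by positivity)] at h
    exact ENNReal.one_le_ofReal.1 h
  rw [← ofReal_measureReal]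
  refine ENNReal.ofReal_le_ofReal ?_
  rw [mul_div_assoc] at hreal
  linarith

lemma exists_linearIsometryEquiv_apply_eq {E : Type*} [NormedAddCommGroup E]
    [InnerProductSpace ℝ E] {x y : E} (h : ‖x‖ = ‖y‖) : ∃ O : E ≃ₗᵢ[ℝ] E, O x = y :=
  ⟨_, Submodule.reflection_sub h⟩

lemma le_stdGaussian_cone {n : ℕ} (hn : 0 < n) {a c : ℝ} (ha : 0 ≤ a) (ha1 : a ≤ 1)
    (hc : c ^ 2 * (n + 1) = a ^ 2) (x : EuclideanSpace ℝ (Fin (n + 1))) :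
    ENNReal.ofReal (1 / 2 - a / √(2 * Real.pi)) ≤
      stdGaussian (EuclideanSpace ℝ (Fin (n + 1))) {y | c * (‖x‖ * ‖y‖) ≤ ⟪x, y⟫} := by
  obtain ⟨O, hO⟩ := exists_linearIsometryEquiv_apply_eq
    (x := x) (y := ‖x‖ • EuclideanSpace.single (0 : Fin (n + 1)) (1 : ℝ)) (by simp [norm_smul])
  refine (le_stdGaussian_head hn ha ha1 hc).trans ?_
  rw [← stdGaussian_map O, Measure.map_apply (by fun_prop)
    (measurableSet_le (by fun_prop) (by fun_prop)), stdGaussian_map]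
  refine measure_mono fun y hy ↦ ?_
  have hy' : c * ‖O y‖ ≤ O y 0 := hy
  rw [O.norm_map] at hy'
  change c * (‖x‖ * ‖y‖) ≤ ⟪x, y⟫
  rw [← O.inner_map_map, hO, real_inner_smul_left, EuclideanSpace.inner_single_left]
  simp only [map_one, one_mul]
  nlinarith [mul_le_mul_of_nonneg_left hy' (norm_nonneg x)]

/-- Averaging over a Gaussian direction: under a rotation-invariant law, a cone condition relative
to a fixed vector holds, jointly with a norm constraint, at least as often as the product of the
two probabilities. -/
lemma mul_le_measure_annulus_inter_cone {E : Type*} [NormedAddCommGroup E]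
    [InnerProductSpace ℝ E] [FiniteDimensional ℝ E] [MeasurableSpace E] [BorelSpace E]
    (μ : Measure E) [IsProbabilityMeasure μ] (hrot : ∀ O : E ≃ₗᵢ[ℝ] E, μ.map O = μ)
    (γ : Measure E) [IsProbabilityMeasure γ] (c r₁ r₂ : ℝ) (q : ENNReal)
    (hγ : ∀ x, q ≤ γ {y | c * (‖x‖ * ‖y‖) ≤ ⟪x, y⟫}) {Φ : E} (hΦ : Φ ≠ 0) (hγ0 : γ {0} = 0) :
    μ {x | r₁ ≤ ‖x‖ ∧ ‖x‖ ≤ r₂} * q ≤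
      μ {x | (r₁ ≤ ‖x‖ ∧ ‖x‖ ≤ r₂) ∧ c * (‖x‖ * ‖Φ‖) ≤ ⟪x, Φ⟫} := by
  set T := {x : E | r₁ ≤ ‖x‖ ∧ ‖x‖ ≤ r₂} with hT_def
  set S : Set (E × E) := {p | p.1 ∈ T ∧ c * (‖p.1‖ * ‖p.2‖) ≤ ⟪p.1, p.2⟫}
  have hT : MeasurableSet T :=
    (measurableSet_le measurable_const measurable_norm).inter
      (measurableSet_le measurable_norm measurable_const)
  have hC : MeasurableSet {p : E × E | c * (‖p.1‖ * ‖p.2‖) ≤ ⟪p.1, p.2⟫} :=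
    measurableSet_le (by fun_prop) (by fun_prop)
  have hS : MeasurableSet S :=
    (hT.preimage measurable_fst).inter hC
  have hconst (y : E) (hy : y ≠ 0) :
      μ ((fun x ↦ (x, y)) ⁻¹' S) = μ ((fun x ↦ (x, Φ)) ⁻¹' S) := by
    have hy0 : 0 < ‖y‖ := norm_pos_iff.2 hy
    have hΦ0 : 0 < ‖Φ‖ := norm_pos_iff.2 hΦ
    obtain ⟨O, hO⟩ := exists_linearIsometryEquiv_apply_eq (x := y) (y := (‖y‖ / ‖Φ‖) • Φ) (by
      rw [norm_smul, Real.norm_of_nonneg (by positivity)]; field_simp)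
    conv_rhs => rw [← hrot O]
    rw [Measure.map_apply (by fun_prop) (hS.preimage (by fun_prop))]
    congr 1
    ext x
    have hin : ⟪x, y⟫ = ‖y‖ / ‖Φ‖ * ⟪O x, Φ⟫ := by
      rw [← O.inner_map_map, hO, real_inner_smul_right]
    simp only [S, T, Set.mem_preimage, Set.mem_ofPred_eq, O.norm_map, hin]
    refine and_congr_right fun _ ↦ ?_
    rw [show c * (‖x‖ * ‖y‖) = ‖y‖ / ‖Φ‖ * (c * (‖x‖ * ‖Φ‖)) by field_simp]
    exact mul_le_mul_iff_right₀ (by positivity)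
  calc μ T * q = ∫⁻ _ in T, q ∂μ := by rw [setLIntegral_const, mul_comm]
    _ ≤ ∫⁻ x in T, γ (Prod.mk x ⁻¹' S) ∂μ := by
        refine setLIntegral_mono' hT fun x hx ↦ (hγ x).trans (measure_mono fun y hy ↦ ⟨hx, hy⟩)
    _ ≤ ∫⁻ x, γ (Prod.mk x ⁻¹' S) ∂μ := setLIntegral_le_lintegral _ _
    _ = ∫⁻ y, μ ((fun x ↦ (x, y)) ⁻¹' S) ∂γ := by
        rw [← Measure.prod_apply hS, Measure.prod_apply_symm hS]
    _ = ∫⁻ _, μ ((fun x ↦ (x, Φ)) ⁻¹' S) ∂γ := by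
        refine lintegral_congr_ae ?_
        filter_upwards [measure_eq_zero_iff_ae_notMem.1 hγ0] with y hy
        exact hconst y hy
    _ = _ := by rw [lintegral_const, measure_univ, mul_one]; rfl

lemma stdGaussian_singleton_zero (n : ℕ) :
    stdGaussian (EuclideanSpace ℝ (Fin (n + 1))) {0} = 0 := by
  have : NullSingletonClass (gaussianReal 0 1) := nullSingletonClass_gaussianReal one_ne_zero
  rw [← map_pi_eq_stdGaussian, Measure.map_apply (by fun_prop) (measurableSet_singleton 0)]
  refine measure_mono_null (fun y hy ↦ ?_) (Measure.pi_hyperplane (fun _ ↦ gaussianReal 0 1) 0 0)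
  have hy' : WithLp.toLp 2 y = 0 := hy
  simpa using congrArg (fun z : EuclideanSpace ℝ (Fin (n + 1)) ↦ z 0) hy'

/-- `k₁` and `k₂` play the roles of `b₁ d` and `b₂ d`. -/
lemma norm_sub_le_of_cone {E : Type*} [NormedAddCommGroup E] [InnerProductSpace ℝ E]
    {k₁ k₂ : ℝ} (hk₂ : 1 ≤ k₂) {V Φ : E}
    (h₁ : ‖Φ‖ / √k₂ ≤ ‖V‖) (h₂ : ‖V‖ ≤ ‖Φ‖ / √k₁)
    (h : 3 / 2 / √k₁ * (‖V‖ * ‖Φ‖) ≤ ⟪V, Φ⟫) : ‖V - Φ‖ ≤ ‖Φ‖ - ‖Φ‖ / k₂ := by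
  have hk₂0 : 0 < k₂ := by linarith
  have hs : 0 ≤ ‖Φ‖ - ‖Φ‖ / k₂ := sub_nonneg.2 (div_le_self (norm_nonneg _) hk₂)
  refine (sq_le_sq₀ (norm_nonneg _) hs).1 ?_
  have hlow : ‖Φ‖ ^ 2 / k₂ ≤ ‖V‖ ^ 2 := by
    have := pow_le_pow_left₀ (by positivity) h₁ 2
    rwa [div_pow, Real.sq_sqrt hk₂0.le] at this
  have hinner : 3 / 2 * ‖V‖ ^ 2 ≤ ⟪V, Φ⟫ := by
    refine le_trans ?_ h
    calc 3 / 2 * ‖V‖ ^ 2 = 3 / 2 * ‖V‖ * ‖V‖ := by ring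
      _ ≤ 3 / 2 * ‖V‖ * (‖Φ‖ / √k₁) := by gcongr
      _ = _ := by ring
  rw [norm_sub_sq_real]
  have : (‖Φ‖ - ‖Φ‖ / k₂) ^ 2 = ‖Φ‖ ^ 2 - 2 * (‖Φ‖ ^ 2 / k₂) + (‖Φ‖ / k₂) ^ 2 := by ring
  rw [this]
  nlinarith [sq_nonneg (‖Φ‖ / k₂)]

/-- **Lemma** (deficiency margin for rotation-invariant distributions): let `d ≥ 20`,
`b₂ > b₁ ≥ 1` and `Φ ∈ ℝ^d`.  If `μ` is a rotation-invariant probability distribution on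
`ℝ^d` with a density (absolutely continuous w.r.t. Lebesgue measure) such that
`P[‖Φ‖₂/√(b₂d) ≤ ‖V‖₂ ≤ ‖Φ‖₂/√(b₁d)] ≥ 1 − ε` for some `0 < ε < 1`, then with probability
at least `(1 − ε)(3 − 4F(2/√b₁))/2`, `V` has deficiency margin `‖Φ‖₂/(b₂d)` w.r.t. `Φ`,
i.e. `‖V − Φ‖₂ ≤ ‖Φ‖₂ − ‖Φ‖₂/(b₂d)`. -/
theorem rotation_invariant_deficiency_margin
    (d : ℕ) (hd : 20 ≤ d) (b₁ b₂ : ℝ) (hb₁ : 1 ≤ b₁) (hb : b₁ < b₂)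
    (Φ : EuclideanSpace ℝ (Fin d))
    (μ : Measure (EuclideanSpace ℝ (Fin d))) (hμ : IsProbabilityMeasure μ)
    (hrot : ∀ O : EuclideanSpace ℝ (Fin d) ≃ₗᵢ[ℝ] EuclideanSpace ℝ (Fin d),
      Measure.map O μ = μ)
    (hac : μ ≪ volume)
    (ε : ℝ) (hε0 : 0 < ε) (hε1 : ε < 1)
    (hconc : ENNReal.ofReal (1 - ε) ≤
      μ {V | ‖Φ‖ / Real.sqrt (b₂ * (d : ℝ)) ≤ ‖V‖ ∧ ‖V‖ ≤ ‖Φ‖ / Real.sqrt (b₁ * (d : ℝ))}) :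
    ENNReal.ofReal ((1 - ε) * (3 - 4 * stdGaussCDF (2 / Real.sqrt b₁)) / 2) ≤
      μ {V | ‖V - Φ‖ ≤ ‖Φ‖ - ‖Φ‖ / (b₂ * (d : ℝ))} := by
  obtain ⟨n, rfl⟩ : ∃ n, d = n + 1 := ⟨d - 1, by omega⟩
  have hn : 0 < n := by omega
  have hd1 : (1 : ℝ) ≤ ((n + 1 : ℕ) : ℝ) := by exact_mod_cast (by omega : 1 ≤ n + 1)
  have hdpos : (0 : ℝ) < ((n + 1 : ℕ) : ℝ) := by linarith
  have hΦ : Φ ≠ 0 := by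
    rintro rfl
    have hzero : μ {0} = 0 := hac (by simp)
    have hset : {V : EuclideanSpace ℝ (Fin (n + 1)) | ‖(0 : EuclideanSpace ℝ (Fin (n + 1)))‖ /
        √(b₂ * ((n + 1 : ℕ) : ℝ)) ≤ ‖V‖ ∧ ‖V‖ ≤ ‖(0 : EuclideanSpace ℝ (Fin (n + 1)))‖ /
        √(b₁ * ((n + 1 : ℕ) : ℝ))} = {0} := by
      ext V; simp
    rw [hset, hzero, nonpos_iff_eq_zero, ENNReal.ofReal_eq_zero] at hconc
    linarith
  set w := 2 / √b₁ with hw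
  have hb₁0 : 0 < √b₁ := Real.sqrt_pos.2 (by linarith)
  have hw0 : 0 ≤ w := by positivity
  have hπ : 0 < √(2 * Real.pi) := by positivity
  rcases le_or_gt w 1 with hw1 | hw1
  · have hcdf := le_two_mul_stdGaussCDF hw0 hw1
    have hcone := mul_le_measure_annulus_inter_cone μ hrot
      (stdGaussian (EuclideanSpace ℝ (Fin (n + 1))))
      (3 / 2 / √(b₁ * ((n + 1 : ℕ) : ℝ))) (‖Φ‖ / √(b₂ * ((n + 1 : ℕ) : ℝ)))
      (‖Φ‖ / √(b₁ * ((n + 1 : ℕ) : ℝ))) _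
      (le_stdGaussian_cone hn (a := 3 / 4 * w) (by positivity) (by linarith) (by
        rw [hw, div_pow, mul_pow, div_pow, div_pow 2, Real.sq_sqrt (by positivity),
          Real.sq_sqrt (by positivity)]
        push_cast
        field_simp
        norm_num)) hΦ (stdGaussian_singleton_zero n)
    calc ENNReal.ofReal ((1 - ε) * (3 - 4 * stdGaussCDF w) / 2)
        ≤ ENNReal.ofReal ((1 - ε) * (1 / 2 - 3 / 4 * w / √(2 * Real.pi))) := by
          refine ENNReal.ofReal_le_ofReal ?_
          rw [mul_div_assoc]
          refine mul_le_mul_of_nonneg_left ?_ (by linarith)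
          have h0 : 0 ≤ w / √(2 * Real.pi) := by positivity
          rw [mul_div_assoc] at hcdf ⊢
          linarith
      _ = ENNReal.ofReal (1 - ε) * ENNReal.ofReal (1 / 2 - 3 / 4 * w / √(2 * Real.pi)) :=
          ENNReal.ofReal_mul (by linarith)
      _ ≤ _ := mul_le_mul_left hconc _
      _ ≤ _ := hcone
      _ ≤ _ := measure_mono fun V hV ↦ norm_sub_le_of_cone (by nlinarith)
          hV.1.1 hV.1.2 hV.2
  · have hcdf := le_two_mul_stdGaussCDF zero_le_one le_rfl
    have hmono : stdGaussCDF 1 ≤ stdGaussCDF w :=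
      measureReal_mono (μ := gaussianReal 0 1) (Set.Iic_subset_Iic.2 hw1.le)
    have hsqrt : √(2 * Real.pi) ≤ 10 / 3 := by
      rw [Real.sqrt_le_left (by norm_num)]
      linarith [Real.pi_lt_d2]
    have hhalf : 1 / 2 ≤ 5 / 3 * 1 / √(2 * Real.pi) := by
      rw [le_div_iff₀ hπ]; linarith
    rw [ENNReal.ofReal_of_nonpos]
    · exact zero_le
    · have := mul_nonneg (by linarith : 0 ≤ 1 - ε) (by linarith : 0 ≤ 4 * stdGaussCDF w - 3)
      linarith
end
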